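/- Consider the infinite-volume classical sandpile model on ℤ with parallel toppling map T, started from a random configuration η with law μ_ρ. If 1 < ρ < 2, then lim_{T→∞} (1/T) ∑_{t=1}^{T} α_ρ(t) = 1/2, where α_ρ(t) = μ_ρ(η : T^t(η)(0) ≥ 2) is the density of unstable sites at time t. -/

import Mathlib

open MeasureTheory Filter Topology

/-- The parallel toppling map of the classical sandpile model on `ℤ`:
every unstable site (height `≥ 2`) loses two particles, one to each neighbor. -/
def parT (η : ℤ → ℕ) : ℤ → ℕ := fun x =>
  (η x - if 2 ≤ η x then 2 else 0)
    + (if 2 ≤ η (x - 1) then 1 else 0)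
    + (if 2 ≤ η (x + 1) then 1 else 0)

open ProbabilityTheory

/-- The number of topplings at `x` during the first `t` parallel updates. -/
def odometer (η : ℤ → ℕ) (t : ℕ) (x : ℤ) : ℤ :=
  ∑ s ∈ Finset.range t, if 2 ≤ (parT^[s] η) x then 1 else 0

lemma odometer_zero (η : ℤ → ℕ) (x : ℤ) : odometer η 0 x = 0 := by
  simp [odometer]

lemma odometer_succ (η : ℤ → ℕ) (t : ℕ) (x : ℤ) :
    odometer η (t + 1) x = odometer η t x + if 2 ≤ (parT^[t] η) x then 1 else 0 := by
  rw [odometer, Finset.sum_range_succ, ← odometer]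

lemma iterate_parT_eq (η : ℤ → ℕ) (t : ℕ) (x : ℤ) :
    ((parT^[t] η) x : ℤ) =
      η x - 2 * odometer η t x + odometer η t (x - 1) + odometer η t (x + 1) := by
  induction t generalizing x with
  | zero => simp [odometer_zero]
  | succ t ih =>
    have h := ih x
    rw [Function.iterate_succ_apply', odometer_succ, odometer_succ, odometer_succ]
    generalize parT^[t] η = ξ at *
    simp only [parT]
    split_ifs <;> omega

/-- Lower barrier for the odometer: `(t + a x - 1) / 2` is a subsolution. -/
lemma le_odometer (η : ℤ → ℕ) (a : ℤ → ℤ) (ha : ∀ x, a x ≤ 1)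
    (hodd : ∀ x, Odd (a (x + 1) - a x))
    (hlap : ∀ x, 2 - 2 * (η x : ℤ) ≤ a (x + 1) + a (x - 1) - 2 * a x) (t : ℕ) (x : ℤ) :
    t + a x - 1 ≤ 2 * odometer η t x := by
  induction t generalizing x with
  | zero => simpa [odometer_zero] using ha x
  | succ t ih =>
    have h := iterate_parT_eq η t x
    have h0 := ih x
    have h1 := ih (x + 1)
    have h2 := ih (x - 1)
    obtain ⟨p, hp⟩ := hodd x
    obtain ⟨q, hq⟩ := hodd (x - 1)
    rw [sub_add_cancel] at hq
    have hl := hlap x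
    rw [odometer_succ]
    push_cast
    split_ifs <;> omega

/-- Upper barrier for the odometer: `(t + b x) / 2` is a supersolution. -/
lemma odometer_le (η : ℤ → ℕ) (b : ℤ → ℤ) (hb : ∀ x, 0 ≤ b x)
    (hodd : ∀ x, Odd (b (x + 1) - b x))
    (hlap : ∀ x, b (x + 1) + b (x - 1) - 2 * b x ≤ 4 - 2 * (η x : ℤ)) (t : ℕ) (x : ℤ) :
    2 * odometer η t x ≤ t + b x := by
  induction t generalizing x with
  | zero => simpa [odometer_zero] using hb x
  | succ t ih =>
    have h := iterate_parT_eq η t x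
    have h0 := ih x
    have h1 := ih (x + 1)
    have h2 := ih (x - 1)
    obtain ⟨p, hp⟩ := hodd x
    obtain ⟨q, hq⟩ := hodd (x - 1)
    rw [sub_add_cancel] at hq
    have hl := hlap x
    rw [odometer_succ]
    push_cast
    split_ifs <;> omega

/-- A function on `ℤ` with Laplacian `2 * (s - η)` away from the origin. -/
lemma exists_laplacian_eq (η : ℤ → ℕ) (s c : ℤ) (hc : Odd c) :
    ∃ a : ℤ → ℤ, (∀ x, Odd (a (x + 1) - a x)) ∧ a (0 + 1) + a (0 - 1) - 2 * a 0 = 2 * c ∧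
      (∀ x, x ≠ 0 → a (x + 1) + a (x - 1) - 2 * a x = 2 * (s - η x)) ∧
      (∀ n : ℕ, a (n + 1 : ℕ) - a n =
        c + 2 * (s * n - ∑ i ∈ Finset.range n, (η (i + 1) : ℤ))) ∧
      (∀ n : ℕ, a (-(n + 1 : ℕ)) - a (-n) =
        c + 2 * (s * n - ∑ i ∈ Finset.range n, (η (-(i + 1)) : ℤ))) := by
  let slope (ω : ℕ → ℕ) (n : ℕ) : ℤ :=
    c + 2 * (s * n - ∑ i ∈ Finset.range n, (ω i : ℤ))
  have slope_zero (ω : ℕ → ℕ) : slope ω 0 = c := by simp [slope]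
  have slope_succ (ω : ℕ → ℕ) (n : ℕ) : slope ω (n + 1) - slope ω n = 2 * (s - ω n) := by
    simp only [slope, Finset.sum_range_succ]; push_cast; ring
  have slope_odd (ω : ℕ → ℕ) (n : ℕ) : Odd (slope ω n) := hc.add_even (even_two_mul _)
  let ωr : ℕ → ℕ := fun i => η (i + 1)
  let ωl : ℕ → ℕ := fun i => η (-(i + 1))
  let a : ℤ → ℤ := fun x => if 0 ≤ x then ∑ k ∈ Finset.range x.toNat, slope ωr k
    else ∑ k ∈ Finset.range (-x).toNat, slope ωl k
  have ar (n : ℕ) : a n = ∑ k ∈ Finset.range n, slope ωr k := by simp [a]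
  have al (n : ℕ) : a (-n) = ∑ k ∈ Finset.range n, slope ωl k := by
    rcases n with _ | n
    · simp [a]
    · have h : ¬ (0 : ℤ) ≤ -((n + 1 : ℕ) : ℤ) := by omega
      simp only [a, if_neg h, neg_neg, Int.toNat_natCast]
  have dr (n : ℕ) : a (n + 1 : ℕ) - a n = slope ωr n := by
    rw [ar, ar, Finset.sum_range_succ]; ring
  have dl (n : ℕ) : a (-(n + 1 : ℕ)) - a (-n) = slope ωl n := by
    rw [al, al, Finset.sum_range_succ]; ring
  refine ⟨a, fun x => ?_, ?_, fun x hx => ?_, dr, dl⟩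
  · rcases le_or_gt 0 x with h | h
    · lift x to ℕ using h
      exact_mod_cast dr x ▸ slope_odd ωr x
    · obtain ⟨n, rfl⟩ : ∃ n : ℕ, x = -(n + 1 : ℕ) := ⟨(-x - 1).toNat, by omega⟩
      rw [show -((n + 1 : ℕ) : ℤ) + 1 = -n by push_cast; ring, ← neg_sub, dl]
      exact (slope_odd ωl n).neg
  · have h1 := dr 0
    have h2 := dl 0
    rw [slope_zero] at h1 h2
    norm_num at h1 h2 ⊢
    linarith
  · rcases lt_or_gt_of_ne hx with h | h
    · obtain ⟨n, rfl⟩ : ∃ n : ℕ, x = -(n + 1 : ℕ) := ⟨(-x - 1).toNat, by omega⟩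
      rw [show -((n + 1 : ℕ) : ℤ) + 1 = -n by push_cast; ring,
        show -((n + 1 : ℕ) : ℤ) - 1 = -(n + 1 + 1 : ℕ) by push_cast; ring]
      have h1 := dl n
      have h2 := dl (n + 1)
      have h3 := slope_succ ωl n
      have h4 : ωl n = η (-(n + 1 : ℕ)) := by simp [ωl]
      rw [h4] at h3
      linarith
    · obtain ⟨n, rfl⟩ : ∃ n : ℕ, x = (n + 1 : ℕ) := ⟨(x - 1).toNat, by omega⟩
      rw [show ((n + 1 : ℕ) : ℤ) + 1 = (n + 1 + 1 : ℕ) by push_cast; ring,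
        show ((n + 1 : ℕ) : ℤ) - 1 = n by push_cast; ring]
      have h1 := dr n
      have h2 := dr (n + 1)
      have h3 := slope_succ ωr n
      have h4 : ωr n = η (n + 1 : ℕ) := by simp [ωr]
      rw [h4] at h3
      linarith

lemma exists_upper_bound_of_eventually_antitone (f : ℕ → ℤ)
    (hf : ∀ᶠ n in atTop, f (n + 1) ≤ f n) : ∃ M, ∀ n, f n ≤ M := by
  obtain ⟨N, hN⟩ := eventually_atTop.1 hf
  obtain ⟨M, hM⟩ := ((Finset.range (N + 1)).image f).bddAbove
  have hM' (n : ℕ) (hn : n ≤ N) : f n ≤ M :=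
    hM (by simpa using ⟨n, by omega, rfl⟩)
  refine ⟨M, fun n => ?_⟩
  rcases le_total n N with h | h
  · exact hM' n h
  · induction n, h using Nat.le_induction with
    | base => exact hM' N le_rfl
    | succ n hn ih => exact (hN n hn).trans ih

lemma exists_upper_bound_int (a : ℤ → ℤ) (hr : ∀ᶠ n : ℕ in atTop, a (n + 1 : ℕ) ≤ a n)
    (hl : ∀ᶠ n : ℕ in atTop, a (-(n + 1 : ℕ)) ≤ a (-n)) : ∃ M, ∀ x, a x ≤ M := by
  obtain ⟨M, hM⟩ := exists_upper_bound_of_eventually_antitone (fun n : ℕ => a n) hr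
  obtain ⟨M', hM'⟩ := exists_upper_bound_of_eventually_antitone (fun n : ℕ => a (-n)) hl
  refine ⟨max M M', fun x => ?_⟩
  obtain ⟨n, rfl | rfl⟩ := Int.eq_nat_or_neg x
  · exact (hM n).trans (le_max_left _ _)
  · exact (hM' n).trans (le_max_right _ _)

lemma exists_le_odometer (η : ℤ → ℕ)
    (hr : ∀ᶠ n : ℕ in atTop, (n : ℤ) + 1 ≤ ∑ i ∈ Finset.range n, (η (i + 1) : ℤ))
    (hl : ∀ᶠ n : ℕ in atTop, (n : ℤ) + 1 ≤ ∑ i ∈ Finset.range n, (η (-(i + 1)) : ℤ)) :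
    ∃ C : ℤ, ∀ t : ℕ, t - C ≤ 2 * odometer η t 0 := by
  obtain ⟨a, hodd, h0, hlap, dr, dl⟩ := exists_laplacian_eq η 1 1 odd_one
  obtain ⟨M, hM⟩ := exists_upper_bound_int a
    (hr.mono fun n hn => by have := dr n; linarith)
    (hl.mono fun n hn => by have := dl n; linarith)
  refine ⟨M - a 0, fun t => ?_⟩
  have h := le_odometer η (fun x => a x - M + 1) (fun x => by linarith [hM x])
    (fun x => by simpa using hodd x) (fun x => ?_) t 0
  · linarith
  · rcases eq_or_ne x 0 with rfl | hx
    · linarith [Int.natCast_nonneg (η 0)]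
    · linarith [hlap x hx]

lemma exists_odometer_le (η : ℤ → ℕ)
    (hr : ∀ K : ℤ, ∀ᶠ n : ℕ in atTop, ∑ i ∈ Finset.range n, (η (i + 1) : ℤ) + K ≤ 2 * n)
    (hl : ∀ K : ℤ, ∀ᶠ n : ℕ in atTop, ∑ i ∈ Finset.range n, (η (-(i + 1)) : ℤ) + K ≤ 2 * n) :
    ∃ C : ℤ, ∀ t : ℕ, 2 * odometer η t 0 ≤ t + C := by
  obtain ⟨b, hodd, h0, hlap, dr, dl⟩ := exists_laplacian_eq η 2 (1 - 2 * η 0)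
    (odd_one.sub_even (even_two_mul _))
  obtain ⟨M, hM⟩ := exists_upper_bound_int (fun x => -b x)
    ((hr (η 0)).mono fun n hn => by have := dr n; linarith)
    ((hl (η 0)).mono fun n hn => by have := dl n; linarith)
  refine ⟨b 0 + M, fun t => ?_⟩
  have h := odometer_le η (fun x => b x + M) (fun x => by linarith [hM x])
    (fun x => by simpa using hodd x) (fun x => ?_) t 0
  · linarith
  · rcases eq_or_ne x 0 with rfl | hx
    · linarith [Int.natCast_nonneg (η 0)]
    · linarith [hlap x hx]

lemma tendsto_sub_mul_atTop_of_tendsto_div {S : ℕ → ℝ} {ρ s : ℝ} (hs : s < ρ)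
    (h : Tendsto (fun n : ℕ => S n / n) atTop (𝓝 ρ)) :
    Tendsto (fun n : ℕ => S n - s * n) atTop atTop := by
  have h1 := (tendsto_natCast_atTop_atTop (R := ℝ)).atTop_mul_pos (sub_pos.2 hs)
    (h.sub_const s)
  refine h1.congr' ((eventually_gt_atTop 0).mono fun n hn => ?_)
  have : (n : ℝ) ≠ 0 := by positivity
  field_simp

lemma tendsto_odometer_div (η : ℤ → ℕ) {ρ : ℝ} (hρ₁ : 1 < ρ) (hρ₂ : ρ < 2)
    (hr : Tendsto (fun n : ℕ => (∑ i ∈ Finset.range n, (η (i + 1) : ℝ)) / n) atTop (𝓝 ρ))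
    (hl : Tendsto (fun n : ℕ => (∑ i ∈ Finset.range n, (η (-(i + 1)) : ℝ)) / n) atTop (𝓝 ρ)) :
    Tendsto (fun t : ℕ => (odometer η t 0 : ℝ) / t) atTop (𝓝 (1 / 2)) := by
  have lower {ω : ℕ → ℕ}
      (h : Tendsto (fun n : ℕ => (∑ i ∈ Finset.range n, (ω i : ℝ)) / n) atTop (𝓝 ρ)) :
      ∀ᶠ n : ℕ in atTop, (n : ℤ) + 1 ≤ ∑ i ∈ Finset.range n, (ω i : ℤ) := by
    filter_upwards [(tendsto_sub_mul_atTop_of_tendsto_div hρ₁ h).eventually_ge_atTop 1] with n hn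
    have : (n : ℝ) + 1 ≤ ∑ i ∈ Finset.range n, (ω i : ℝ) := by linarith
    exact_mod_cast this
  have upper {ω : ℕ → ℕ}
      (h : Tendsto (fun n : ℕ => (∑ i ∈ Finset.range n, (ω i : ℝ)) / n) atTop (𝓝 ρ)) (K : ℤ) :
      ∀ᶠ n : ℕ in atTop, ∑ i ∈ Finset.range n, (ω i : ℤ) + K ≤ 2 * n := by
    have h' : Tendsto (fun n : ℕ => (-∑ i ∈ Finset.range n, (ω i : ℝ)) / n) atTop (𝓝 (-ρ)) := by
      simpa only [neg_div] using h.neg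
    filter_upwards [(tendsto_sub_mul_atTop_of_tendsto_div (neg_lt_neg hρ₂) h').eventually_ge_atTop
      (K : ℝ)] with n hn
    have : ∑ i ∈ Finset.range n, (ω i : ℝ) + K ≤ 2 * n := by linarith
    exact_mod_cast this
  obtain ⟨C, hC⟩ := exists_le_odometer η (lower hr) (lower hl)
  obtain ⟨D, hD⟩ := exists_odometer_le η (upper hr) (upper hl)
  have lim (E : ℝ) : Tendsto (fun t : ℕ => 1 / 2 + E / t) atTop (𝓝 (1 / 2)) := by
    simpa using (tendsto_const_div_atTop_nhds_zero_nat E).const_add (1 / 2 : ℝ)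
  refine tendsto_of_tendsto_of_tendsto_of_le_of_le' (lim (-C / 2)) (lim (D / 2)) ?_ ?_
  · filter_upwards [eventually_gt_atTop 0] with t ht
    have h : (t : ℝ) - C ≤ 2 * odometer η t 0 := by exact_mod_cast hC t
    have ht' : (0 : ℝ) < t := by positivity
    rw [le_div_iff₀ ht', add_mul, div_mul_cancel₀ _ ht'.ne']
    linarith
  · filter_upwards [eventually_gt_atTop 0] with t ht
    have h : 2 * (odometer η t 0 : ℝ) ≤ t + D := by exact_mod_cast hD t
    have ht' : (0 : ℝ) < t := by positivity
    rw [div_le_iff₀ ht', add_mul, div_mul_cancel₀ _ ht'.ne']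
    linarith

lemma hasSum_poissonMeasure_mul_id (r : NNReal) :
    HasSum (fun n : ℕ => Real.exp (-r) * (r : ℝ) ^ n / n.factorial * n) r := by
  rw [← hasSum_nat_add_iff' 1]
  convert! (hasSum_one_poissonMeasure r).mul_left (r : ℝ) using 1
  · funext n
    rw [Nat.factorial_succ]
    push_cast
    have : (n.factorial : ℝ) ≠ 0 := by positivity
    field_simp
    ring
  · simp

lemma integrable_natCast_poissonMeasure (r : NNReal) :
    Integrable (fun n : ℕ => (n : ℝ)) (poissonMeasure r) := by
  rw [integrable_poissonMeasure_iff]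
  simpa using (hasSum_poissonMeasure_mul_id r).summable

lemma integral_natCast_poissonMeasure (r : NNReal) :
    ∫ n : ℕ, (n : ℝ) ∂poissonMeasure r = r := by
  rw [integral_poissonMeasure]
  simpa using (hasSum_poissonMeasure_mul_id r).tsum_eq

lemma map_eval_eq_poissonMeasure {r : NNReal} {μ : Measure (ℤ → ℕ)}
    (hμ : ∀ (S : Finset ℤ) (k : ℤ → ℕ),
      μ {η | ∀ x ∈ S, η x = k x}
        = ∏ x ∈ S, ENNReal.ofReal (Real.exp (-r) * (r : ℝ) ^ k x / (k x).factorial)) (x : ℤ) :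
    μ.map (fun η => η x) = poissonMeasure r := by
  refine Measure.ext_of_singleton fun n => ?_
  rw [Measure.map_apply (measurable_pi_apply x) (measurableSet_singleton n),
    poissonMeasure_singleton]
  have h := hμ {x} (fun _ => n)
  rw [Finset.prod_singleton] at h
  rw [← h]
  congr 1
  ext η
  simp

lemma indepFun_of_cylinder {r : NNReal} {μ : Measure (ℤ → ℕ)} [IsProbabilityMeasure μ]
    (hμ : ∀ (S : Finset ℤ) (k : ℤ → ℕ),
      μ {η | ∀ x ∈ S, η x = k x}
        = ∏ x ∈ S, ENNReal.ofReal (Real.exp (-r) * (r : ℝ) ^ k x / (k x).factorial))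
    {x y : ℤ} (hxy : x ≠ y) :
    IndepFun (fun η : ℤ → ℕ => η x) (fun η => η y) μ := by
  rw [indepFun_iff_map_prod_eq_prod_map_map (measurable_pi_apply x).aemeasurable
    (measurable_pi_apply y).aemeasurable, map_eval_eq_poissonMeasure hμ,
    map_eval_eq_poissonMeasure hμ]
  refine Measure.ext_of_singleton fun ⟨m, n⟩ => ?_
  rw [Measure.map_apply (by fun_prop) (measurableSet_singleton _),
    ← Set.singleton_prod_singleton, Measure.prod_prod, poissonMeasure_singleton,
    poissonMeasure_singleton]
  have h := hμ {x, y} (fun z => if z = x then m else n)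
  rw [Finset.prod_pair hxy] at h
  simp only [if_true, if_neg hxy.symm] at h
  rw [← h]
  congr 1
  ext η
  simp [hxy.symm]

lemma ae_tendsto_average_of_cylinder {r : NNReal} {μ : Measure (ℤ → ℕ)} [IsProbabilityMeasure μ]
    (hμ : ∀ (S : Finset ℤ) (k : ℤ → ℕ),
      μ {η | ∀ x ∈ S, η x = k x}
        = ∏ x ∈ S, ENNReal.ofReal (Real.exp (-r) * (r : ℝ) ^ k x / (k x).factorial))
    {e : ℕ → ℤ} (he : Function.Injective e) :
    ∀ᵐ η ∂μ, Tendsto (fun n : ℕ => (∑ i ∈ Finset.range n, (η (e i) : ℝ)) / n) atTop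
      (𝓝 (r : ℝ)) := by
  have hlaw (x : ℤ) := map_eval_eq_poissonMeasure hμ x
  have hcast : Measurable (fun n : ℕ => (n : ℝ)) := measurable_from_top
  have hint : Integrable (fun η : ℤ → ℕ => (η (e 0) : ℝ)) μ := by
    have h := integrable_natCast_poissonMeasure r
    rw [← hlaw (e 0)] at h
    exact h.comp_measurable (measurable_pi_apply (e 0))
  have hmean : ∫ η, (η (e 0) : ℝ) ∂μ = r := by
    rw [← integral_natCast_poissonMeasure r, ← hlaw (e 0),
      integral_map (measurable_pi_apply (e 0)).aemeasurable hcast.aestronglyMeasurable]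
  have h := strong_law_ae_real (fun i (η : ℤ → ℕ) => (η (e i) : ℝ)) hint
    (fun i j hij => (indepFun_of_cylinder hμ (he.ne hij)).comp hcast hcast)
    (fun i => IdentDistrib.comp (μ := μ) (ν := μ) (f := fun η : ℤ → ℕ => η (e i))
      (g := fun η : ℤ → ℕ => η (e 0)) ⟨(measurable_pi_apply _).aemeasurable, (measurable_pi_apply _).aemeasurable,
        by rw [hlaw, hlaw]⟩ hcast)
  rwa [hmean] at h

lemma measurable_parT : Measurable parT := by
  refine measurable_pi_lambda _ fun x => ?_
  have h (y : ℤ) : Measurable fun η : ℤ → ℕ => η y := measurable_pi_apply y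
  have hf : Measurable fun n : ℕ => n - if 2 ≤ n then 2 else 0 := measurable_from_top
  have hg : Measurable fun n : ℕ => if 2 ≤ n then 1 else 0 := measurable_from_top
  exact ((hf.comp (h x)).add (hg.comp (h (x - 1)))).add (hg.comp (h (x + 1)))

lemma measurableSet_unstable (t : ℕ) (x : ℤ) :
    MeasurableSet {η : ℤ → ℕ | 2 ≤ (parT^[t] η) x} :=
  measurableSet_le measurable_const ((measurable_pi_apply x).comp (measurable_parT.iterate t))

lemma odometer_cast_eq (η : ℤ → ℕ) (t : ℕ) (x : ℤ) :
    (odometer η t x : ℝ) = ∑ s ∈ Finset.range t,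
      Set.indicator {η : ℤ → ℕ | 2 ≤ (parT^[s] η) x} (fun _ => (1 : ℝ)) η := by
  simp [odometer, Set.indicator_apply]

lemma measurable_odometer (t : ℕ) (x : ℤ) :
    Measurable fun η : ℤ → ℕ => (odometer η t x : ℝ) := by
  simp only [odometer_cast_eq]
  exact Finset.measurable_sum _ fun s _ => measurable_const.indicator (measurableSet_unstable s x)

lemma integral_odometer (μ : Measure (ℤ → ℕ)) [IsProbabilityMeasure μ] (t : ℕ) (x : ℤ) :
    ∫ η, (odometer η t x : ℝ) ∂μ =
      ∑ s ∈ Finset.range t, (μ {η | 2 ≤ (parT^[s] η) x}).toReal := by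
  simp only [odometer_cast_eq]
  rw [integral_finsetSum _ fun s _ =>
    (integrable_const (1 : ℝ)).indicator (measurableSet_unstable s x)]
  refine Finset.sum_congr rfl fun s _ => ?_
  rw [integral_indicator_const _ (measurableSet_unstable s x)]
  simp [Measure.real]

lemma odometer_nonneg (η : ℤ → ℕ) (t : ℕ) (x : ℤ) : 0 ≤ odometer η t x :=
  Finset.sum_nonneg fun s _ => by split_ifs <;> norm_num

lemma odometer_le_time (η : ℤ → ℕ) (t : ℕ) (x : ℤ) : odometer η t x ≤ t := by
  refine (Finset.sum_le_card_nsmul _ _ 1 fun s _ => ?_).trans (by simp)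
  split_ifs <;> norm_num

lemma tendsto_integral_odometer_div {ρ : ℝ} (hρ₁ : 1 < ρ) (hρ₂ : ρ < 2)
    (μ : Measure (ℤ → ℕ)) [IsProbabilityMeasure μ]
    (hμ : ∀ (S : Finset ℤ) (k : ℤ → ℕ),
      μ {η | ∀ x ∈ S, η x = k x}
        = ∏ x ∈ S, ENNReal.ofReal (Real.exp (-ρ) * ρ ^ k x / (k x).factorial)) :
    Tendsto (fun t : ℕ => ∫ η, (odometer η t 0 : ℝ) / t ∂μ) atTop (𝓝 (1 / 2)) := by
  lift ρ to NNReal using by linarith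
  have h := tendsto_integral_of_dominated_convergence (μ := μ)
    (F := fun (t : ℕ) η => (odometer η t 0 : ℝ) / t) (f := fun _ => (1 / 2 : ℝ)) (fun _ => 1)
    (fun t => ((measurable_odometer t 0).div_const _).aestronglyMeasurable)
    (integrable_const _) (fun t => ae_of_all _ fun η => ?_) ?_
  · simpa using h
  · have h0 : (0 : ℝ) ≤ odometer η t 0 := by exact_mod_cast odometer_nonneg η t 0
    have h1 : (odometer η t 0 : ℝ) ≤ t := by exact_mod_cast odometer_le_time η t 0
    rw [Real.norm_of_nonneg (by positivity)]
    exact div_le_one_of_le₀ h1 (by positivity)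
  · filter_upwards [ae_tendsto_average_of_cylinder hμ (e := fun i => (i : ℤ) + 1)
      (fun i j h => by simpa using h),
      ae_tendsto_average_of_cylinder hμ (e := fun i => -((i : ℤ) + 1))
      (fun i j h => by simpa using h)] with η hr hl
    exact tendsto_odometer_div η hρ₁ hρ₂ hr hl

/-- in the infinite-volume classical sandpile on `ℤ` started from
i.i.d. Poisson(`ρ`) heights (`μ` is the product measure with Poisson-`ρ` marginals)
with `1 < ρ < 2`, the Cesàro averages of the densities
`α_ρ(t) = μ(T^t η has an unstable site at 0)` of unstable sites converge to `1/2`. -/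
theorem activity_density_intermediate (ρ : ℝ) (hρ₁ : 1 < ρ) (hρ₂ : ρ < 2)
    (μ : Measure (ℤ → ℕ)) [IsProbabilityMeasure μ]
    (hμ : ∀ (S : Finset ℤ) (k : ℤ → ℕ),
      μ {η | ∀ x ∈ S, η x = k x}
        = ∏ x ∈ S, ENNReal.ofReal (Real.exp (-ρ) * ρ ^ k x / (k x).factorial)) :
    Tendsto
      (fun T : ℕ =>
        (1 / (T : ℝ)) * ∑ t ∈ Finset.Icc 1 T, (μ {η | 2 ≤ (parT^[t] η) 0}).toReal)
      atTop (𝓝 (1 / 2)) := by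
  have hsum (T : ℕ) : ∑ t ∈ Finset.Icc 1 T, (μ {η | 2 ≤ (parT^[t] η) 0}).toReal =
      ∫ η, (odometer η (T + 1) 0 : ℝ) ∂μ - (μ {η | 2 ≤ (parT^[0] η) 0}).toReal := by
    rw [integral_odometer, Finset.range_eq_Ico, Finset.sum_eq_sum_Ico_succ_bot (by omega),
      zero_add, add_sub_cancel_left, Finset.Ico_add_one_right_eq_Icc]
  simp only [hsum]
  have h1 := (tendsto_integral_odometer_div hρ₁ hρ₂ μ hμ).comp (tendsto_add_atTop_nat 1)
  have h2 : Tendsto (fun T : ℕ => 1 + 1 / (T : ℝ)) atTop (𝓝 1) := by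
    simpa using (tendsto_const_div_atTop_nhds_zero_nat (1 : ℝ)).const_add (1 : ℝ)
  have h3 := tendsto_const_div_atTop_nhds_zero_nat (μ {η | 2 ≤ (parT^[0] η) 0}).toReal
  have h4 := (h2.mul h1).sub h3
  rw [one_mul, sub_zero] at h4
  refine h4.congr' ((eventually_gt_atTop 0).mono fun T hT => ?_)
  have hT' : (T : ℝ) ≠ 0 := by positivity
  have hT1 : (T : ℝ) + 1 ≠ 0 := by positivity
  simp only [Function.comp_apply, integral_div]
  push_cast
  field_simp
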